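/- Let φ be a comparison function, (X, d) a compact metric space with a fixed base point x_*, and (E, ‖·‖_E) a normed space. A non-empty subset A of the little Lipschitz space lip_φ(X,E) is precompact (with respect to the norm ‖f‖_φ = ‖f(x_*)‖_E + |f|_φ) if and only if (i) the sections A(x) := {f(x) : f ∈ A} are precompact in E for every x ∈ X, and (ii) A is uniformly locally flat, i.e., for every ε > 0 there exists δ > 0 such that for all x, y ∈ X with d(x,y) ≤ δ one has ‖f(x) − f(y)‖_E ≤ ε φ(d(x,y)) for every f ∈ A. -/

import Mathlib

open Pointwise Metric

/-- A comparison function. -/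
structure IsCompFun (φ : ℝ → ℝ) : Prop where
  nonneg : ∀ t : ℝ, 0 ≤ t → 0 ≤ φ t
  map_zero : φ 0 = 0
  right_cont : ContinuousWithinAt φ (Set.Ici 0) 0
  concave : ConcaveOn ℝ (Set.Ici 0) φ
  ne_zero : ∃ t : ℝ, 0 ≤ t ∧ φ t ≠ 0

/-- The Lipschitz seminorm `|f|_φ`. -/
noncomputable def lipSemi {X E : Type*} [MetricSpace X] [NormedAddCommGroup E]
    (φ : ℝ → ℝ) (f : X → E) : ℝ :=
  sSup {r : ℝ | ∃ x y : X, x ≠ y ∧ r = ‖f x - f y‖ / φ (dist x y)}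

/-- Membership in `Lip_φ(X,E)`. -/
def MemLip {X E : Type*} [MetricSpace X] [NormedAddCommGroup E]
    (φ : ℝ → ℝ) (f : X → E) : Prop :=
  BddAbove {r : ℝ | ∃ x y : X, x ≠ y ∧ r = ‖f x - f y‖ / φ (dist x y)}

/-- Local flatness of a map, i.e. membership in the little Lipschitz space
`lip_φ(X,E)` (together with `MemLip`): for every `ε > 0` there is `δ > 0` such that
`‖f x - f y‖ ≤ ε φ(d(x,y))` whenever `d(x,y) ≤ δ`. -/
def LocFlat {X E : Type*} [MetricSpace X] [NormedAddCommGroup E]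
    (φ : ℝ → ℝ) (f : X → E) : Prop :=
  ∀ ε : ℝ, 0 < ε → ∃ δ : ℝ, 0 < δ ∧
    ∀ x y : X, dist x y ≤ δ → ‖f x - f y‖ ≤ ε * φ (dist x y)

/-- The norm `‖f‖_φ = ‖f x₀‖ + |f|_φ`. -/
noncomputable def lipNorm {X E : Type*} [MetricSpace X] [NormedAddCommGroup E]
    (φ : ℝ → ℝ) (x₀ : X) (f : X → E) : ℝ :=
  ‖f x₀‖ + lipSemi φ f

/-- Precompactness of `A` with respect to the gauge `N`. -/
def Precomp {α : Type*} [Sub α] (N : α → ℝ) (A : Set α) : Prop :=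
  ∀ ε : ℝ, 0 < ε → ∃ T : Set α, T ⊆ A ∧ T.Finite ∧ ∀ f ∈ A, ∃ g ∈ T, N (f - g) ≤ ε

theorem IsCompFun.pos {φ : ℝ → ℝ} (hφ : IsCompFun φ) {t : ℝ} (ht : 0 < t) : 0 < φ t := by
  obtain ⟨s, hs, hφs⟩ := hφ.ne_zero
  have hφs' : 0 < φ s := lt_of_le_of_ne (hφ.nonneg s hs) (Ne.symm hφs)
  have hs' : 0 < s := lt_of_le_of_ne hs fun h ↦ hφs (h ▸ hφ.map_zero)
  rcases le_total t s with hts | hst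
  · have h := hφ.concave.2 (Set.self_mem_Ici (a := (0 : ℝ))) (show s ∈ Set.Ici 0 from hs)
      (sub_nonneg.2 ((div_le_one hs').2 hts)) (by positivity : 0 ≤ t / s) (by ring)
    simp only [smul_eq_mul, hφ.map_zero, mul_zero, zero_add, div_mul_cancel₀ t hs'.ne'] at h
    exact lt_of_lt_of_le (by positivity) h
  · have h := hφ.concave.2 (show s ∈ Set.Ici 0 from hs)
      (show 2 * t - s ∈ Set.Ici 0 by simp only [Set.mem_Ici]; linarith)
      (by norm_num : (0 : ℝ) ≤ 1 / 2) (by norm_num : (0 : ℝ) ≤ 1 / 2) (by norm_num)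
    have h0 := hφ.nonneg (2 * t - s) (by linarith)
    simp only [smul_eq_mul] at h
    rw [show 1 / 2 * s + 1 / 2 * (2 * t - s) = t by ring] at h
    linarith

theorem MemLip.norm_apply_sub_le {X E : Type*} [MetricSpace X] [NormedAddCommGroup E]
    {φ : ℝ → ℝ} (hφ : IsCompFun φ) {f : X → E} (hf : MemLip φ f) (x y : X) :
    ‖f x - f y‖ ≤ lipSemi φ f * φ (dist x y) := by
  rcases eq_or_ne x y with rfl | hxy
  · simp [hφ.map_zero]
  · rw [← div_le_iff₀ (hφ.pos (dist_pos.2 hxy))]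
    exact le_csSup hf ⟨x, y, hxy, rfl⟩

theorem lipSemi_nonneg {X E : Type*} [MetricSpace X] [NormedAddCommGroup E]
    {φ : ℝ → ℝ} (hφ : IsCompFun φ) (f : X → E) : 0 ≤ lipSemi φ f := by
  apply Real.sSup_nonneg
  rintro r ⟨x, y, -, rfl⟩
  exact div_nonneg (norm_nonneg _) (hφ.nonneg _ dist_nonneg)

theorem lipSemi_le {X E : Type*} [MetricSpace X] [NormedAddCommGroup E]
    {φ : ℝ → ℝ} (hφ : IsCompFun φ) {f : X → E} {C : ℝ} (hC : 0 ≤ C)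
    (h : ∀ x y, x ≠ y → ‖f x - f y‖ ≤ C * φ (dist x y)) : lipSemi φ f ≤ C := by
  apply Real.sSup_le _ hC
  rintro r ⟨x, y, hxy, rfl⟩
  exact (div_le_iff₀ (hφ.pos (dist_pos.2 hxy))).2 (h x y hxy)

theorem MemLip.sub {X E : Type*} [MetricSpace X] [NormedAddCommGroup E]
    {φ : ℝ → ℝ} (hφ : IsCompFun φ) {f g : X → E} (hf : MemLip φ f) (hg : MemLip φ g) :
    MemLip φ (f - g) := by
  refine ⟨lipSemi φ f + lipSemi φ g, ?_⟩
  rintro r ⟨x, y, hxy, rfl⟩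
  rw [div_le_iff₀ (hφ.pos (dist_pos.2 hxy)), Pi.sub_apply, Pi.sub_apply, sub_sub_sub_comm, add_mul]
  exact (norm_sub_le _ _).trans
    (add_le_add (hf.norm_apply_sub_le hφ x y) (hg.norm_apply_sub_le hφ x y))

/-- On a bounded space, `φ (dist x y)` is bounded away from zero for well-separated points. -/
theorem IsCompFun.exists_pos_le {X : Type*} [MetricSpace X] [CompactSpace X]
    {φ : ℝ → ℝ} (hφ : IsCompFun φ) {δ : ℝ} (hδ : 0 < δ) :
    ∃ m : ℝ, 0 < m ∧ ∀ x y : X, δ ≤ dist x y → m ≤ φ (dist x y) := by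
  have hD : 0 < δ + diam (Set.univ : Set X) := add_pos_of_pos_of_nonneg hδ diam_nonneg
  refine ⟨min (φ δ) (φ (δ + diam (Set.univ : Set X))), lt_min (hφ.pos hδ) (hφ.pos hD),
    fun x y hxy ↦ hφ.concave.min_le_of_mem_Icc hδ.le hD.le ⟨hxy, ?_⟩⟩
  have := dist_le_diam_of_mem (isCompact_univ (X := X)).isBounded (Set.mem_univ x) (Set.mem_univ y)
  linarith

/-- A family of maps with totally bounded sections admits finite nets for uniform closeness on
a finite set of points. -/
theorem exists_finite_net_of_totallyBounded_sections {X E : Type*} [PseudoMetricSpace E]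
    {A : Set (X → E)} {F : Set X} (hF : F.Finite)
    (hA : ∀ x ∈ F, TotallyBounded ((fun f : X → E ↦ f x) '' A)) {η : ℝ} (hη : 0 < η) :
    ∃ T ⊆ A, T.Finite ∧ ∀ f ∈ A, ∃ g ∈ T, ∀ x ∈ F, dist (f x) (g x) < η := by
  have : Finite F := hF
  choose t ht hcov using fun x : F ↦ Metric.totallyBounded_iff.1 (hA x x.2) (η / 2) (half_pos hη)
  have hp : ∀ f : A, ∀ x : F, ∃ e ∈ t x, dist (f.1 x) e < η / 2 := fun f x ↦ by
    simpa using hcov x ⟨f.1, f.2, rfl⟩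
  choose p hpt hp using hp
  obtain ⟨T, -, hT⟩ := Set.exists_subset_bijOn Set.univ p
  have himg : (p '' Set.univ).Finite := (Set.Finite.pi ht).subset (by
    rintro _ ⟨f, -, rfl⟩ x -
    exact hpt f x)
  have hTfin : T.Finite := Set.Finite.of_finite_image (hT.image_eq ▸ himg) hT.injOn
  refine ⟨Subtype.val '' T, by simp, hTfin.image _, fun f hf ↦ ?_⟩
  obtain ⟨g, hg, hgf⟩ := hT.surjOn ⟨⟨f, hf⟩, Set.mem_univ _, rfl⟩
  refine ⟨g, ⟨g, hg, rfl⟩, fun x hx ↦ ?_⟩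
  have h₁ := hp ⟨f, hf⟩ ⟨x, hx⟩
  have h₂ := hp g ⟨x, hx⟩
  rw [hgf] at h₂
  linarith [dist_triangle_right (f x) (g.1 x) (p ⟨f, hf⟩ ⟨x, hx⟩)]

/-- An Arzelà–Ascoli type statement: a uniformly equicontinuous family on a compact space with
totally bounded sections admits finite nets for uniform closeness. -/
theorem exists_finite_uniform_net {X E : Type*} [PseudoMetricSpace X] [CompactSpace X]
    [PseudoMetricSpace E] {A : Set (X → E)}
    (hA : ∀ x, TotallyBounded ((fun f : X → E ↦ f x) '' A))
    (hequi : ∀ η : ℝ, 0 < η → ∃ δ : ℝ, 0 < δ ∧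
      ∀ x y : X, dist x y ≤ δ → ∀ f ∈ A, dist (f x) (f y) ≤ η) {η : ℝ} (hη : 0 < η) :
    ∃ T ⊆ A, T.Finite ∧ ∀ f ∈ A, ∃ g ∈ T, ∀ x, dist (f x) (g x) ≤ η := by
  obtain ⟨δ, hδ, hAδ⟩ := hequi (η / 3) (by positivity)
  obtain ⟨F, -, hF, hcov⟩ := finite_cover_balls_of_compact (isCompact_univ (X := X)) hδ
  obtain ⟨T, hTA, hT, hnet⟩ := exists_finite_net_of_totallyBounded_sections hF
    (fun x _ ↦ hA x) (η := η / 3) (by positivity)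
  refine ⟨T, hTA, hT, fun f hf ↦ ?_⟩
  obtain ⟨g, hg, hfg⟩ := hnet f hf
  refine ⟨g, hg, fun x ↦ ?_⟩
  obtain ⟨y, hy, hxy⟩ : ∃ y ∈ F, dist x y < δ := by simpa using hcov (Set.mem_univ x)
  have h₁ := hAδ x y hxy.le f hf
  have h₂ := hAδ x y hxy.le g (hTA hg)
  have h₃ := hfg y hy
  rw [dist_comm] at h₂
  linarith [dist_triangle4 (f x) (f y) (g y) (g x)]

theorem IsCompFun.exists_dist_le {X E : Type*} [MetricSpace X] [NormedAddCommGroup E]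
    {φ : ℝ → ℝ} (hφ : IsCompFun φ) {A : Set (X → E)}
    (hflat : ∃ δ : ℝ, 0 < δ ∧
      ∀ x y : X, dist x y ≤ δ → ∀ f ∈ A, ‖f x - f y‖ ≤ φ (dist x y)) {η : ℝ} (hη : 0 < η) :
    ∃ δ : ℝ, 0 < δ ∧ ∀ x y : X, dist x y ≤ δ → ∀ f ∈ A, dist (f x) (f y) ≤ η := by
  obtain ⟨δ, hδ, hA⟩ := hflat
  obtain ⟨ρ, hρ, hφρ⟩ := Metric.continuousWithinAt_iff.1 hφ.right_cont η hη
  refine ⟨min δ (ρ / 2), by positivity, fun x y hxy f hf ↦ ?_⟩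
  rw [dist_eq_norm]
  refine (hA x y (hxy.trans (min_le_left _ _)) f hf).trans ?_
  have h₁ := hxy.trans (min_le_right _ _)
  have h₂ := hφρ (x := dist x y) dist_nonneg
    (by rw [Real.dist_0_eq_abs, abs_of_nonneg dist_nonneg]; linarith)
  rw [hφ.map_zero, Real.dist_0_eq_abs] at h₂
  exact (le_abs_self _).trans h₂.le

theorem Precomp.totallyBounded_section {X E : Type*} [MetricSpace X] [NormedAddCommGroup E]
    {φ : ℝ → ℝ} (hφ : IsCompFun φ) {x₀ : X} {A : Set (X → E)} (hA : ∀ f ∈ A, MemLip φ f)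
    (h : Precomp (lipNorm φ x₀) A) (x : X) : TotallyBounded ((fun f : X → E ↦ f x) '' A) := by
  rw [Metric.totallyBounded_iff]
  intro ε hε
  have hφx := hφ.nonneg (dist x x₀) dist_nonneg
  obtain ⟨T, hTA, hT, hnet⟩ := h (ε / (2 * (1 + φ (dist x x₀)))) (by positivity)
  refine ⟨(fun f : X → E ↦ f x) '' T, hT.image _, ?_⟩
  rintro _ ⟨f, hf, rfl⟩
  obtain ⟨g, hg, hfg⟩ := hnet f hf
  simp only [Set.mem_iUnion, mem_ball]
  refine ⟨g x, ⟨g, hg, rfl⟩, ?_⟩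
  rw [le_div_iff₀ (by positivity), lipNorm] at hfg
  have h₁ := ((hA f hf).sub hφ (hA g (hTA hg))).norm_apply_sub_le hφ x x₀
  have h₂ := norm_le_norm_sub_add ((f - g) x) ((f - g) x₀)
  have h₃ := lipSemi_nonneg hφ (f - g)
  rw [dist_eq_norm]
  change ‖(f - g) x‖ < ε
  nlinarith [mul_nonneg (norm_nonneg ((f - g) x₀)) hφx, norm_nonneg ((f - g) x₀)]

theorem Precomp.uniformly_flat {X E : Type*} [MetricSpace X] [NormedAddCommGroup E]
    {φ : ℝ → ℝ} (hφ : IsCompFun φ) {x₀ : X} {A : Set (X → E)}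
    (hA : ∀ f ∈ A, MemLip φ f ∧ LocFlat φ f) (h : Precomp (lipNorm φ x₀) A)
    {ε : ℝ} (hε : 0 < ε) :
    ∃ δ : ℝ, 0 < δ ∧
      ∀ x y : X, dist x y ≤ δ → ∀ f ∈ A, ‖f x - f y‖ ≤ ε * φ (dist x y) := by
  obtain ⟨T, hTA, hT, hnet⟩ := h (ε / 2) (half_pos hε)
  have hTflat : ∃ δ : ℝ, 0 < δ ∧
      ∀ g ∈ T, ∀ x y : X, dist x y ≤ δ → ‖g x - g y‖ ≤ ε / 2 * φ (dist x y) := by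
    clear hnet
    induction T, hT using Set.Finite.induction_on with
    | empty => exact ⟨1, one_pos, by simp⟩
    | @insert g S _ _ ih =>
      obtain ⟨δ₁, hδ₁, h₁⟩ := ih ((Set.subset_insert g S).trans hTA)
      obtain ⟨δ₂, hδ₂, h₂⟩ := (hA g (hTA (Set.mem_insert g S))).2 (ε / 2) (half_pos hε)
      refine ⟨min δ₁ δ₂, lt_min hδ₁ hδ₂, ?_⟩
      rintro k (rfl | hk) x y hxy
      · exact h₂ x y (hxy.trans (min_le_right _ _))
      · exact h₁ k hk x y (hxy.trans (min_le_left _ _))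
  obtain ⟨δ, hδ, hTδ⟩ := hTflat
  refine ⟨δ, hδ, fun x y hxy f hf ↦ ?_⟩
  obtain ⟨g, hg, hfg⟩ := hnet f hf
  have h₁ := ((hA f hf).1.sub hφ (hA g (hTA hg)).1).norm_apply_sub_le hφ x y
  have h₂ := hTδ g hg x y hxy
  have h₃ : lipSemi φ (f - g) ≤ ε / 2 := (le_add_of_nonneg_left (norm_nonneg _)).trans hfg
  have h₄ := mul_le_mul_of_nonneg_right h₃ (hφ.nonneg (dist x y) dist_nonneg)
  have h₅ : f x - f y = ((f - g) x - (f - g) y) + (g x - g y) := by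
    simp only [Pi.sub_apply]; abel
  rw [h₅]
  linarith [norm_add_le ((f - g) x - (f - g) y) (g x - g y)]

theorem precomp_of_uniformly_flat {X E : Type*} [MetricSpace X] [CompactSpace X]
    [NormedAddCommGroup E] {φ : ℝ → ℝ} (hφ : IsCompFun φ) (x₀ : X) {A : Set (X → E)}
    (hA : ∀ x : X, TotallyBounded ((fun f : X → E ↦ f x) '' A))
    (hflat : ∀ ε : ℝ, 0 < ε → ∃ δ : ℝ, 0 < δ ∧
      ∀ x y : X, dist x y ≤ δ → ∀ f ∈ A, ‖f x - f y‖ ≤ ε * φ (dist x y)) :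
    Precomp (lipNorm φ x₀) A := by
  intro ε hε
  obtain ⟨δ, hδ, hAδ⟩ := hflat (ε / 4) (by positivity)
  obtain ⟨m, hm, hmφ⟩ := hφ.exists_pos_le (X := X) hδ
  obtain ⟨T, hTA, hT, hnet⟩ := exists_finite_uniform_net hA
    (fun η hη ↦ hφ.exists_dist_le (by simpa using hflat 1 one_pos) hη)
    (η := min (ε / 2) (ε / 4 * m)) (by positivity)
  refine ⟨T, hTA, hT, fun f hf ↦ ?_⟩
  obtain ⟨g, hg, hfg⟩ := hnet f hf
  refine ⟨g, hg, ?_⟩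
  have h₀ : ‖(f - g) x₀‖ ≤ ε / 2 := by
    rw [Pi.sub_apply, ← dist_eq_norm]
    exact (hfg x₀).trans (min_le_left _ _)
  have hclose : ∀ x, ‖(f - g) x‖ ≤ ε / 4 * m := fun x ↦ by
    rw [Pi.sub_apply, ← dist_eq_norm]
    exact (hfg x).trans (min_le_right _ _)
  have hsemi : lipSemi φ (f - g) ≤ ε / 2 := by
    refine lipSemi_le hφ (half_pos hε).le fun x y _ ↦ ?_
    rcases le_total (dist x y) δ with hxy | hxy
    · rw [Pi.sub_apply, Pi.sub_apply, sub_sub_sub_comm]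
      linarith [norm_sub_le (f x - f y) (g x - g y), hAδ x y hxy f hf, hAδ x y hxy g (hTA hg)]
    · have := mul_le_mul_of_nonneg_left (hmφ x y hxy) (half_pos hε).le
      linarith [norm_sub_le ((f - g) x) ((f - g) y), hclose x, hclose y]
  rw [lipNorm]
  linarith

/-- **Compactness criterion in the little Lipschitz space `lip_φ(X,E)`** for a compact
metric space `X`:  a non-empty `A ⊆ lip_φ(X,E)` is precompact iff all sections `A(x)`
are precompact in `E` and `A` is uniformly locally flat. -/
theorem stmt_19 {X E : Type*} [MetricSpace X] [CompactSpace X]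
    [NormedAddCommGroup E] [NormedSpace ℝ E]
    (φ : ℝ → ℝ) (hφ : IsCompFun φ) (x₀ : X)
    (A : Set (X → E)) (hA : A.Nonempty)
    (hAlip : ∀ f ∈ A, MemLip φ f ∧ LocFlat φ f) :
    Precomp (lipNorm φ x₀) A ↔
      (∀ x : X, TotallyBounded ((fun f : X → E => f x) '' A)) ∧
        (∀ ε : ℝ, 0 < ε → ∃ δ : ℝ, 0 < δ ∧
          ∀ x y : X, dist x y ≤ δ → ∀ f ∈ A, ‖f x - f y‖ ≤ ε * φ (dist x y)) := by
  exact ⟨fun h ↦ ⟨h.totallyBounded_section hφ fun f hf ↦ (hAlip f hf).1,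
    fun _ hε ↦ h.uniformly_flat hφ hAlip hε⟩, fun h ↦ precomp_of_uniformly_flat hφ x₀ h.1 h.2⟩
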